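/- The image P(Ω) equals the ℤ-submodule of V^ generated by the four vectors d_1, d_2, d_3, d_4, where d_2 = (ê_2-f̂_2+f̂_1-ê_1+ĉ_1-â_1-ĉ_2+â_2)/3, d_1 = d_2 - f̂_1 + ê_1, d_3 = â_1 - ĉ_1, d_4 = ĉ_1 - â_1 + ĉ_2 - â_2; these four vectors are linearly independent and their Gram matrix with respect to ⟨·,·⟩^ is [[-4,0,2,0],[0,-4,2,0],[2,2,-4,2],[0,0,2,-4]]. In particular P(Ω) is isometric to D_4(2), the negative definite D_4 root lattice with its bilinear form multiplied by 2. -/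

import Mathlib

/- Context: V = ℚ^22 with the Gram matrix of the paper, Ω = Ω_{2,2} the
co-invariant lattice, V^ = ℚ^14 with its Gram matrix and P = π_{τ*}. -/

noncomputable section
open Matrix

abbrev V : Type := Fin 22 → ℚ

def gramX : Matrix (Fin 22) (Fin 22) ℚ := Matrix.of fun i j =>
  if i = j then
    (if i.val < 16 then -2 else if i.val < 18 then -4 else if i.val < 20 then 0 else 4)
  else if i.val / 2 = j.val / 2 then
    (if i.val < 16 then 1 else if i.val < 18 then 2 else if i.val < 20 then 3 else 2)
  else 0

def B (u v : V) : ℚ := u ⬝ᵥ (gramX *ᵥ v)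

def bv : Fin 22 → V := fun i j => if i = j then 1 else 0

def ΩGens : Set V :=
  {bv 16, bv 17,
   bv 10 - bv 8, bv 11 - bv 9, bv 14 - bv 12, bv 15 - bv 13,
   bv 2 - bv 0, bv 0 - bv 4, bv 4 - bv 6, bv 1 - bv 3, bv 5 - bv 1, bv 7 - bv 5,
   (1/3 : ℚ) • (bv 0 - bv 2 - bv 4 + bv 6 - bv 1 + bv 3 + bv 5 - bv 7 + bv 16 - bv 17),
   (1/3 : ℚ) • (-(bv 0) + bv 6 + bv 1 - bv 7 - bv 8 + bv 10 + bv 9 - bv 11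
      - bv 12 + bv 14 + bv 13 - bv 15),
   (1/3 : ℚ) • (bv 0 + bv 2 - bv 4 - bv 6 - bv 1 - bv 3 + bv 5 + bv 7
      - bv 8 + bv 10 + bv 9 - bv 11)}

def Ω : Submodule ℤ V := Submodule.span ℤ ΩGens

abbrev Vh : Type := Fin 14 → ℚ

def gramH : Matrix (Fin 14) (Fin 14) ℚ := Matrix.of fun i j =>
  if i = j then
    (if i.val < 4 then -2 else if i.val < 8 then -4 else if i.val < 10 then -2
     else if i.val < 12 then 0 else 8)
  else if i.val / 2 = j.val / 2 then
    (if i.val < 4 then 1 else if i.val < 8 then 2 else if i.val < 10 then 1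
     else if i.val < 12 then 6 else 4)
  else 0

def Bh (u v : Vh) : ℚ := u ⬝ᵥ (gramH *ᵥ v)

def P : V → Vh := fun u =>
  ![u 0 + u 2, u 1 + u 3, u 4 + u 6, u 5 + u 7, u 8, u 9, u 10, u 11,
    u 12 + u 14, u 13 + u 15, u 18, u 19, u 20, u 21]

def bvh : Fin 14 → Vh := fun i j => if i = j then 1 else 0

/-- d₂ = (ê₂-f̂₂+f̂₁-ê₁+ĉ₁-â₁-ĉ₂+â₂)/3 -/
def d₂ : Vh := (1/3 : ℚ) •
  (bvh 5 - bvh 7 + bvh 6 - bvh 4 + bvh 2 - bvh 0 - bvh 3 + bvh 1)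
def d₁ : Vh := d₂ - bvh 6 + bvh 4
def d₃ : Vh := bvh 0 - bvh 2
def d₄ : Vh := bvh 2 - bvh 0 + bvh 3 - bvh 1

/-- Gram matrix of D₄(2) (negative definite, doubled). -/
def gramD4 : Matrix (Fin 4) (Fin 4) ℚ :=
  !![-4, 0, 2, 0; 0, -4, 2, 0; 2, 2, -4, 2; 0, 0, 2, -4]

/-- The projection `P` as a `ℤ`-linear map. -/
def projLinear : V →ₗ[ℤ] Vh where
  toFun := P
  map_add' u v := by
    ext i
    fin_cases i <;> simp [P] <;> ring
  map_smul' n u := by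
    ext i
    fin_cases i <;> simp [P]

theorem projLinear_mem_span_of_mem_gens {u : V} (hu : u ∈ ΩGens) :
    projLinear u ∈ Submodule.span ℤ ({d₁, d₂, d₃, d₄} : Set Vh) := by
  have key : ∃ a b c d : ℤ, a • d₁ + b • d₂ + c • d₃ + d • d₄ = projLinear u := by
    simp only [ΩGens, Set.mem_insert_iff, Set.mem_singleton_iff] at hu
    rcases hu with h | h | h | h | h | h | h | h | h | h | h | h | h | h | h <;> subst h
    on_goal 3 => refine ⟨-1, 1, 0, 0, ?_⟩
    on_goal 4 => refine ⟨-1, -2, -2, -1, ?_⟩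
    on_goal 8 => refine ⟨0, 0, 1, 0, ?_⟩
    on_goal 11 => refine ⟨0, 0, 1, 1, ?_⟩
    on_goal 14 => refine ⟨0, 1, 0, 0, ?_⟩
    on_goal 15 => refine ⟨0, 1, 2, 1, ?_⟩
    all_goals try refine ⟨0, 0, 0, 0, ?_⟩
    all_goals decide +kernel
  obtain ⟨a, b, c, d, h⟩ := key
  rw [← h]
  refine add_mem (add_mem (add_mem ?_ ?_) ?_) ?_ <;>
    exact Submodule.smul_mem _ _ (Submodule.subset_span (by simp))

theorem map_projLinear_Ω :
    Ω.map projLinear = Submodule.span ℤ ({d₁, d₂, d₃, d₄} : Set Vh) := by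
  have mem {u : V} (hu : u ∈ ΩGens) : projLinear u ∈ Ω.map projLinear :=
    Submodule.mem_map_of_mem (Submodule.subset_span hu)
  apply le_antisymm
  · rw [Ω, Submodule.map_span, Submodule.span_le]
    rintro _ ⟨u, hu, rfl⟩
    exact projLinear_mem_span_of_mem_gens hu
  · have h₂ : d₂ ∈ Ω.map projLinear := by
      convert mem (u := (1/3 : ℚ) • (-(bv 0) + bv 6 + bv 1 - bv 7 - bv 8 + bv 10 + bv 9 - bv 11
        - bv 12 + bv 14 + bv 13 - bv 15)) (by simp [ΩGens]) using 1
      decide +kernel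
    have h₃ : d₃ ∈ Ω.map projLinear := by
      convert mem (u := bv 0 - bv 4) (by simp [ΩGens]) using 1
      decide +kernel
    have h₁ : d₁ ∈ Ω.map projLinear := by
      convert sub_mem h₂ (mem (u := bv 10 - bv 8) (by simp [ΩGens])) using 1
      decide +kernel
    have h₄ : d₄ ∈ Ω.map projLinear := by
      convert sub_mem (mem (u := bv 5 - bv 1) (by simp [ΩGens])) h₃ using 1
      decide +kernel
    rw [Submodule.span_le]
    rintro _ (rfl | rfl | rfl | rfl) <;> assumption

theorem linearIndependent_d : LinearIndependent ℚ ![d₁, d₂, d₃, d₄] := by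
  rw [Fintype.linearIndependent_iff]
  intro g hg
  have h0 := congrFun hg 0
  have h3 := congrFun hg 3
  have h4 := congrFun hg 4
  have h5 := congrFun hg 5
  simp [Fin.sum_univ_four, d₁, d₂, d₃, d₄, bvh] at h0 h3 h4 h5
  intro i
  fin_cases i <;> simp <;> linarith

theorem Bh_d (i j : Fin 4) :
    Bh (![d₁, d₂, d₃, d₄] i) (![d₁, d₂, d₃, d₄] j) = gramD4 i j := by
  fin_cases i <;> fin_cases j <;> decide +kernel

/-- P(Ω) is the ℤ-span of d₁,d₂,d₃,d₄, these are linearly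
independent, and their Gram matrix is that of D₄(2); in particular
P(Ω) ≅ D₄(2). -/
theorem stmt7 :
    P '' (Ω : Set V) = (Submodule.span ℤ {d₁, d₂, d₃, d₄} : Set Vh) ∧
    LinearIndependent ℚ ![d₁, d₂, d₃, d₄] ∧
    (∀ i j : Fin 4, Bh (![d₁, d₂, d₃, d₄] i) (![d₁, d₂, d₃, d₄] j) = gramD4 i j) := by
  refine ⟨?_, linearIndependent_d, Bh_d⟩
  rw [← map_projLinear_Ω]
  rfl
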